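/- For every fixed λ-term M, the asymptotic density of the set of λ-terms containing M as a subterm equals 1: the sequence Nat.card {T : Term // size T = n ∧ Subterm M T} / L n (as real numbers) tends to 1 as n → ∞. In other words, asymptotically almost all λ-terms contain M as a subterm. -/

import Mathlib

inductive Term : Type
  | idx : ℕ → Term
  | app : Term → Term → Term
  | abs : Term → Term

def Term.size : Term → ℕ
  | .idx n => n + 1
  | .app t u => t.size + u.size + 1
  | .abs t => t.size + 1

noncomputable def L (n : ℕ) : ℕ := Nat.card {t : Term // t.size = n}

inductive Subterm (M : Term) : Term → Prop
  | refl : Subterm M M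
  | abs {t : Term} : Subterm M t → Subterm M (.abs t)
  | appLeft {t : Term} (u : Term) : Subterm M t → Subterm M (.app t u)
  | appRight (t : Term) {u : Term} : Subterm M u → Subterm M (.app t u)

open Finset.HasAntidiagonal (antidiagonal mem_antidiagonal)

lemma Term.size_pos (t : Term) : 0 < t.size := by
  cases t <;> simp [Term.size]

lemma Subterm.size_le {M T : Term} (h : Subterm M T) : M.size ≤ T.size := by
  induction h <;> (try simp only [Term.size]) <;> omega

lemma Term.finite_size_le (n : ℕ) : {t : Term | t.size ≤ n}.Finite := by
  induction n with
  | zero =>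
    convert Set.finite_empty
    ext t
    simpa using t.size_pos.ne'
  | succ n ih =>
    refine ((((Set.finite_Iic n).image Term.idx).union (ih.image Term.abs)).union
      (ih.image2 Term.app ih)).subset ?_
    intro t ht
    cases t with
    | idx k =>
      left; left
      exact ⟨k, by simpa [Term.size] using ht, rfl⟩
    | abs t =>
      left; right
      exact ⟨t, by simpa [Term.size] using ht, rfl⟩
    | app t u =>
      right
      simp only [Term.size, Set.mem_ofPred_eq] at ht
      exact ⟨t, by simp only [Set.mem_ofPred_eq]; omega, u,
        by simp only [Set.mem_ofPred_eq]; omega, rfl⟩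

lemma Term.finite_size_eq (n : ℕ) : {t : Term | t.size = n}.Finite :=
  (Term.finite_size_le n).subset fun _ ht => ht.le

noncomputable def termsOfSize (n : ℕ) : Finset Term := (Term.finite_size_eq n).toFinset

lemma mem_termsOfSize {n : ℕ} {t : Term} : t ∈ termsOfSize n ↔ t.size = n := by
  simp [termsOfSize]

lemma L_eq_card (n : ℕ) : L n = (termsOfSize n).card := by
  rw [L, termsOfSize, ← Set.ncard_eq_toFinset_card _ (Term.finite_size_eq n)]
  rfl

lemma L_zero : L 0 = 0 := by
  rw [L_eq_card, Finset.card_eq_zero, Finset.eq_empty_iff_forall_notMem]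
  intro t ht
  exact t.size_pos.ne' (mem_termsOfSize.1 ht)

open Classical in
/-- The terms of size `n` in which `M` does not occur. -/
noncomputable def termsAvoiding (M : Term) (n : ℕ) : Finset Term :=
  (termsOfSize n).filter fun t => ¬ Subterm M t

lemma mem_termsAvoiding {M t : Term} {n : ℕ} :
    t ∈ termsAvoiding M n ↔ t.size = n ∧ ¬ Subterm M t := by
  simp [termsAvoiding, mem_termsOfSize]

open Classical in
/-- Index, abstractions and applications with immediate subterms taken from a graded family. -/
noncomputable def nextTerms (F : ℕ → Finset Term) (n : ℕ) : Finset Term :=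
  ({Term.idx n} ∪ (F n).image Term.abs) ∪
    (antidiagonal n).biUnion fun p => Finset.image₂ Term.app (F p.1) (F p.2)

lemma card_nextTerms_le (F : ℕ → Finset Term) (n : ℕ) :
    (nextTerms F n).card ≤
      1 + (F n).card + ∑ p ∈ antidiagonal n, (F p.1).card * (F p.2).card := by
  classical
  rw [nextTerms]
  refine (Finset.card_union_le _ _).trans (add_le_add ((Finset.card_union_le _ _).trans
    (add_le_add (by simp) Finset.card_image_le)) (Finset.card_biUnion_le.trans ?_))
  exact Finset.sum_le_sum fun p _ => Finset.card_image₂_le _ _ _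

lemma termsOfSize_succ (n : ℕ) : termsOfSize (n + 1) = nextTerms termsOfSize n := by
  classical
  ext t
  cases t with
  | idx k => simp [nextTerms, mem_termsOfSize, Term.size]
  | abs t => simp [nextTerms, mem_termsOfSize, Term.size]
  | app t u => simp [nextTerms, mem_termsOfSize, Term.size]

lemma L_succ (n : ℕ) :
    L (n + 1) = 1 + L n + ∑ p ∈ antidiagonal n, L p.1 * L p.2 := by
  classical
  simp only [L_eq_card]
  rw [termsOfSize_succ, nextTerms, Finset.card_union_of_disjoint,
    Finset.card_union_of_disjoint, Finset.card_singleton,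
    Finset.card_image_of_injective _ (fun a b h => by injection h), Finset.card_biUnion]
  · congr 1
    refine Finset.sum_congr rfl fun p _ => Finset.card_image₂ (fun a b c d h => ?_) _ _
    injection h with h1 h2
    exact ⟨h1, h2⟩
  · intro p _ q _ hpq
    refine Finset.disjoint_left.2 fun t hp hq => ?_
    simp only [Finset.mem_image₂, mem_termsOfSize] at hp hq
    obtain ⟨a, ha, b, hb, rfl⟩ := hp
    obtain ⟨c, hc, d, hd, h⟩ := hq
    injection h with h1 h2
    subst h1 h2
    exact hpq (Prod.ext (ha.symm.trans hc) (hb.symm.trans hd))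
  · simp
  · simp [Finset.disjoint_left]

lemma card_termsAvoiding_succ_le (M : Term) (n : ℕ) :
    (termsAvoiding M (n + 1)).card + (if n + 1 = M.size then 1 else 0) ≤
      1 + (termsAvoiding M n).card + ∑ p ∈ antidiagonal n,
        (termsAvoiding M p.1).card * (termsAvoiding M p.2).card := by
  classical
  refine le_trans ?_ (card_nextTerms_le _ n)
  have hsub : termsAvoiding M (n + 1) ⊆ nextTerms (termsAvoiding M) n := by
    intro t ht
    rw [mem_termsAvoiding] at ht
    obtain ⟨hs, hM⟩ := ht
    cases t with
    | idx k =>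
      simpa [nextTerms, Term.size] using hs
    | abs t =>
      have : ¬ Subterm M t := fun h => hM h.abs
      simpa [nextTerms, mem_termsAvoiding, this, Term.size] using hs
    | app t u =>
      have h1 : ¬ Subterm M t := fun h => hM (h.appLeft u)
      have h2 : ¬ Subterm M u := fun h => hM (h.appRight t)
      simpa [nextTerms, mem_termsAvoiding, h1, h2, Term.size] using hs
  split_ifs with hn
  · have hnot : M ∉ termsAvoiding M (n + 1) := fun h => (mem_termsAvoiding.1 h).2 .refl
    rw [← Finset.card_insert_of_notMem hnot]
    refine Finset.card_le_card (Finset.insert_subset ?_ hsub)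
    have key : ∀ t : Term, t.size < M.size → ¬ Subterm M t :=
      fun t ht h => absurd h.size_le (by omega)
    cases M with
    | idx k =>
      simpa [nextTerms, Term.size] using hn.symm
    | abs t =>
      have := key t (by simp [Term.size])
      simpa [nextTerms, mem_termsAvoiding, this, Term.size] using hn.symm
    | app t u =>
      have h1 := key t (by simp only [Term.size]; omega)
      have h2 := key u (by simp only [Term.size]; omega)
      simpa [nextTerms, mem_termsAvoiding, h1, h2, Term.size] using hn.symm
  · exact Finset.card_le_card hsub

lemma sum_antidiagonal_le_sq {f : ℕ → ℝ} (hf : ∀ n, 0 ≤ f n) (N : ℕ) :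
    ∑ n ∈ Finset.range N, ∑ p ∈ antidiagonal n, f p.1 * f p.2 ≤
      (∑ n ∈ Finset.range N, f n) ^ 2 := by
  simp only [Finset.sum_sigma']
  rw [sq, Finset.sum_mul_sum, ← Finset.sum_product']
  refine (Finset.sum_nbij (t := (Finset.range N ×ˢ Finset.range N).filter fun p => p.1 + p.2 < N)
    (g := fun p => f p.1 * f p.2) (fun q : (_ : ℕ) × ℕ × ℕ => q.2) ?_ ?_ ?_ (fun _ _ => rfl)).trans_le
    (Finset.sum_le_sum_of_subset_of_nonneg (Finset.filter_subset _ _)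
      fun p _ _ => mul_nonneg (hf _) (hf _))
  · rintro ⟨n, i, j⟩ h
    simp only [Finset.mem_sigma, Finset.mem_range, mem_antidiagonal, Finset.mem_filter,
      Finset.mem_product] at h ⊢
    omega
  · rintro ⟨n, p⟩ h ⟨n', p'⟩ h' heq
    simp only [Finset.coe_sigma, Set.mem_sigma_iff, Finset.mem_coe,
      mem_antidiagonal] at h h'
    obtain rfl : p = p' := heq
    obtain rfl : n = n' := h.2.symm.trans h'.2
    rfl
  · rintro ⟨i, j⟩ h
    simp only [Finset.coe_filter, Set.mem_ofPred_eq] at h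
    exact ⟨⟨i + j, i, j⟩, by simpa using h.2, rfl⟩

lemma sum_range_succ_mul_pow_le {b e : ℕ → ℝ} (hb : ∀ n, 0 ≤ b n) (hb0 : b 0 = 0)
    (h : ∀ n, b (n + 1) + e (n + 1) ≤
      1 + b n + ∑ p ∈ antidiagonal n, b p.1 * b p.2)
    {x : ℝ} (hx0 : 0 ≤ x) (hx1 : x < 1) (N : ℕ) :
    ∑ n ∈ Finset.range (N + 1), b n * x ^ n +
        ∑ n ∈ Finset.range N, e (n + 1) * x ^ (n + 1) ≤
      x / (1 - x) + x * ∑ n ∈ Finset.range N, b n * x ^ n +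
        x * (∑ n ∈ Finset.range N, b n * x ^ n) ^ 2 := by
  have hgeom : ∑ n ∈ Finset.range N, x ^ n ≤ 1 / (1 - x) := by
    rw [one_div, ← tsum_geometric_of_lt_one hx0 hx1]
    exact (summable_geometric_of_lt_one hx0 hx1).sum_le_tsum _ fun i _ => pow_nonneg hx0 i
  have hsq := sum_antidiagonal_le_sq (f := fun n => b n * x ^ n)
    (fun n => mul_nonneg (hb n) (pow_nonneg hx0 n)) N
  calc _ = ∑ n ∈ Finset.range N, (b (n + 1) + e (n + 1)) * x ^ (n + 1) := by
        rw [Finset.sum_range_succ', hb0]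
        simp [add_mul, Finset.sum_add_distrib]
    _ ≤ ∑ n ∈ Finset.range N,
        (1 + b n + ∑ p ∈ antidiagonal n, b p.1 * b p.2) * x ^ (n + 1) :=
        Finset.sum_le_sum fun n _ => mul_le_mul_of_nonneg_right (h n) (by positivity)
    _ = x * ∑ n ∈ Finset.range N, x ^ n + x * ∑ n ∈ Finset.range N, b n * x ^ n +
        x * ∑ n ∈ Finset.range N, ∑ p ∈ antidiagonal n,
          (b p.1 * x ^ p.1) * (b p.2 * x ^ p.2) := by
        simp only [Finset.mul_sum, ← Finset.sum_add_distrib]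
        refine Finset.sum_congr rfl fun n _ => ?_
        rw [add_mul, Finset.sum_mul]
        congr 1
        · ring
        · refine Finset.sum_congr rfl fun p hp => ?_
          rw [← mem_antidiagonal.1 hp]
          ring
    _ ≤ _ := by
        rw [div_eq_mul_one_div x (1 - x)]
        gcongr

/-- The dominant singularity of the generating function of all terms. -/
lemma exists_singularity : ∃ r : ℝ, 0 < r ∧ r < 1 ∧ (1 - r) ^ 3 = 4 * r ^ 2 := by
  have hc : ContinuousOn (fun r : ℝ => 4 * r ^ 2 - (1 - r) ^ 3) (Set.Icc 0 1) := by fun_prop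
  obtain ⟨r, ⟨h0, h1⟩, hr⟩ := intermediate_value_Ioo (by norm_num) hc
    (show (0 : ℝ) ∈ Set.Ioo _ _ by norm_num)
  exact ⟨r, h0, h1, by simp only at hr; linarith⟩

lemma singularity_fixed_point {r : ℝ} (h0 : 0 < r) (h1 : r < 1)
    (hr : (1 - r) ^ 3 = 4 * r ^ 2) :
    r / (1 - r) + r * ((1 - r) / (2 * r)) + r * ((1 - r) / (2 * r)) ^ 2 =
      (1 - r) / (2 * r) := by
  have : 1 - r ≠ 0 := by linarith
  field_simp
  linear_combination -hr

lemma sum_L_mul_pow_le {r : ℝ} (h0 : 0 < r) (h1 : r < 1)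
    (hr : (1 - r) ^ 3 = 4 * r ^ 2) (N : ℕ) :
    ∑ n ∈ Finset.range N, (L n : ℝ) * r ^ n ≤ (1 - r) / (2 * r) := by
  have h1' : 0 < 1 - r := by linarith
  induction N with
  | zero => simp only [Finset.range_zero, Finset.sum_empty]; positivity
  | succ N ih =>
    have := sum_range_succ_mul_pow_le (b := fun n => (L n : ℝ)) (e := 0)
      (fun n => Nat.cast_nonneg _) (by simp [L_zero])
      (fun n => by simp only [L_succ]; push_cast; simp) h0.le h1 N
    simp only [Pi.zero_apply, zero_mul, Finset.sum_const_zero, add_zero] at this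
    refine this.trans ?_
    conv_rhs => rw [← singularity_fixed_point h0 h1 hr]
    have : 0 ≤ ∑ n ∈ Finset.range N, (L n : ℝ) * r ^ n :=
      Finset.sum_nonneg fun n _ => by positivity
    gcongr

lemma not_summable_L {x : ℝ} (h0 : 0 < x) (h1 : x < 1) (hx : (1 - x) ^ 3 < 4 * x ^ 2) :
    ¬ Summable fun n => (L n : ℝ) * x ^ n := by
  intro hs
  have h1' : 0 < 1 - x := by linarith
  have hn : Summable fun n => ‖(L n : ℝ) * x ^ n‖ := hs.norm
  have hsq := tsum_mul_tsum_eq_tsum_sum_antidiagonal_of_summable_norm hn hn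
  have hcs := (summable_norm_sum_mul_antidiagonal_of_summable_norm hn hn).of_norm
  have hg := summable_geometric_of_lt_one h0.le h1
  have key : ∑' n, (L n : ℝ) * x ^ n = x * (∑' n, x ^ n) + x * (∑' n, (L n : ℝ) * x ^ n) +
      x * ((∑' n, (L n : ℝ) * x ^ n) * (∑' n, (L n : ℝ) * x ^ n)) := by
    conv_lhs => rw [hs.tsum_eq_zero_add]
    rw [hsq, ← tsum_mul_left, ← tsum_mul_left, ← tsum_mul_left,
      ← (hg.mul_left x).tsum_add (hs.mul_left x),
      ← ((hg.mul_left x).add (hs.mul_left x)).tsum_add (hcs.mul_left x)]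
    simp only [L_zero, Nat.cast_zero, zero_mul, zero_add]
    refine tsum_congr fun n => ?_
    rw [L_succ]
    push_cast
    rw [add_mul, Finset.sum_mul, Finset.mul_sum]
    congr 1
    · ring
    · refine Finset.sum_congr rfl fun p hp => ?_
      rw [← mem_antidiagonal.1 hp]
      ring
  rw [tsum_geometric_of_lt_one h0.le h1] at key
  set S := ∑' n, (L n : ℝ) * x ^ n
  field_simp at key
  nlinarith [sq_nonneg (2 * x * S - (1 - x)),
    mul_nonneg h1'.le (sq_nonneg (2 * x * S - (1 - x)))]

lemma one_le_L {n : ℕ} (hn : 1 ≤ n) : 1 ≤ L n := by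
  obtain ⟨k, rfl⟩ := Nat.exists_eq_add_of_le' hn
  rw [L_succ]
  omega

lemma L_mul_le (i j : ℕ) : L i * L j ≤ L (i + j + 1) := by
  rw [L_succ]
  have := Finset.single_le_sum (s := antidiagonal (i + j))
    (f := fun p => L p.1 * L p.2) (fun _ _ => Nat.zero_le _)
    (mem_antidiagonal.2 (rfl : (i, j).1 + (i, j).2 = i + j))
  simp only at this
  omega

lemma exists_le_L_mul_pow {r y : ℝ} (h0 : 0 < r) (hry : r < y) (h1 : y < 1)
    (hr : (1 - r) ^ 3 = 4 * r ^ 2) :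
    ∃ c > 0, ∀ n ≥ 1, c ≤ (L n : ℝ) * y ^ n := by
  have hy0 : 0 < y := h0.trans hry
  obtain ⟨j, hj⟩ : ∃ j, 1 ≤ (L j : ℝ) * y ^ (j + 1) := by
    by_contra! hcon
    obtain ⟨z, hrz, hzy⟩ := exists_between hry
    have hz0 : 0 < z := h0.trans hrz
    refine not_summable_L hz0 (hzy.trans h1) ?_ ?_
    · calc (1 - z) ^ 3 < (1 - r) ^ 3 := by
            have : 0 ≤ 1 - z := by linarith
            gcongr
        _ = 4 * r ^ 2 := hr
        _ < 4 * z ^ 2 := by gcongr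
    · refine Summable.of_nonneg_of_le (fun n => by positivity) (fun n => ?_)
        ((summable_geometric_of_lt_one (r := z / y) (by positivity)
          ((div_lt_one hy0).2 hzy)).mul_left y⁻¹)
      have h := (hcon n).le
      rw [div_pow, ← mul_div_assoc, le_div_iff₀ (by positivity)]
      calc (L n : ℝ) * z ^ n * y ^ n = y⁻¹ * z ^ n * (L n * y ^ (n + 1)) := by
            rw [pow_succ]; field_simp
        _ ≤ y⁻¹ * z ^ n * 1 := by gcongr
        _ = _ := mul_one _
  refine ⟨y ^ (j + 1), by positivity, fun n => ?_⟩
  induction n using Nat.strong_induction_on with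
  | _ n ih =>
    intro hn
    rcases le_or_gt n (j + 1) with hnj | hnj
    · have : (1 : ℝ) ≤ L n := by exact_mod_cast one_le_L hn
      calc y ^ (j + 1) ≤ y ^ n := pow_le_pow_of_le_one hy0.le h1.le hnj
        _ ≤ L n * y ^ n := le_mul_of_one_le_left (by positivity) this
    · obtain ⟨k, rfl⟩ := Nat.exists_eq_add_of_lt hnj
      have hk := ih (k + 1) (by omega) (by omega)
      have hmul : (L (k + 1) : ℝ) * L j ≤ L (j + 1 + k + 1) := by
        have := L_mul_le (k + 1) j
        rw [show k + 1 + j + 1 = j + 1 + k + 1 by ring] at this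
        exact_mod_cast this
      calc y ^ (j + 1) ≤ L (k + 1) * y ^ (k + 1) := hk
        _ ≤ L (k + 1) * y ^ (k + 1) * (L j * y ^ (j + 1)) :=
            le_mul_of_one_le_right (by positivity) hj
        _ = L (k + 1) * L j * y ^ (j + 1 + k + 1) := by ring
        _ ≤ _ := by gcongr

lemma card_termsAvoiding_le (M : Term) (n : ℕ) : (termsAvoiding M n).card ≤ L n := by
  rw [L_eq_card]
  exact Finset.card_le_card fun t ht => mem_termsOfSize.2 (mem_termsAvoiding.1 ht).1

lemma card_termsAvoiding_size_lt (M : Term) : (termsAvoiding M M.size).card + 1 ≤ L M.size := by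
  classical
  rw [L_eq_card]
  exact Finset.card_lt_card (Finset.filter_ssubset.2
    ⟨M, mem_termsOfSize.2 rfl, not_not.2 .refl⟩)

lemma exists_mul_pow_le_of_base_lt {a : ℕ → ℝ} {m : ℕ} (ha : ∀ n, 0 ≤ a n) (ha0 : a 0 = 0)
    (hm : 0 < m)
    (hrec : ∀ n, a (n + 1) + (if n + 1 = m then 1 else 0) ≤
      1 + a n + ∑ p ∈ antidiagonal n, a p.1 * a p.2)
    {r v : ℝ} (h0 : 0 < r) (h1 : r < 1) (hv : r / (1 - r) + r * v + r * v ^ 2 = v)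
    (hbase : ∑ n ∈ Finset.range (m + 1), a n * r ^ n < v) :
    ∃ x, r < x ∧ x < 1 ∧ ∃ C : ℝ, ∀ n, a n * x ^ n ≤ C := by
  have hstep : r / (1 - r) + r * v + r * v ^ 2 - r ^ m < v := by
    linarith [pow_pos h0 m]
  have hc1 : ContinuousAt (fun x : ℝ => ∑ n ∈ Finset.range (m + 1), a n * x ^ n) r := by
    fun_prop
  have hc2 : ContinuousAt (fun x : ℝ => x / (1 - x) + x * v + x * v ^ 2 - x ^ m) r := by
    have : 1 - r ≠ 0 := by linarith
    fun_prop (disch := assumption)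
  have hev := (hc1.eventually_lt continuousAt_const hbase).and
    ((hc2.eventually_lt continuousAt_const hstep).and (eventually_lt_nhds h1))
  obtain ⟨x, ⟨hx1, hx2, hx3⟩, hx4⟩ :=
    ((hev.filter_mono nhdsWithin_le_nhds).and
      (self_mem_nhdsWithin : Set.Ioi r ∈ nhdsWithin r (Set.Ioi r))).exists
  have hx0 : 0 < x := h0.trans hx4
  have hnn : ∀ n, 0 ≤ a n * x ^ n := fun n => mul_nonneg (ha n) (by positivity)
  have hsum : ∀ k, ∑ n ∈ Finset.range (m + 1 + k), a n * x ^ n ≤ v := by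
    intro k
    induction k with
    | zero => exact hx1.le
    | succ k ih =>
      have hle := sum_range_succ_mul_pow_le (e := fun n => if n = m then 1 else 0)
        ha ha0 hrec hx0.le hx3 (m + 1 + k)
      have he : x ^ m ≤ ∑ n ∈ Finset.range (m + 1 + k),
          (if n + 1 = m then (1 : ℝ) else 0) * x ^ (n + 1) := by
        have hterm := Finset.single_le_sum (s := Finset.range (m + 1 + k))
          (f := fun n => (if n + 1 = m then (1 : ℝ) else 0) * x ^ (n + 1))
          (fun n _ => by positivity) (Finset.mem_range.2 (show m - 1 < m + 1 + k by omega))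
        simpa only [Nat.sub_add_cancel hm, if_true, one_mul] using hterm
      have hP : 0 ≤ ∑ n ∈ Finset.range (m + 1 + k), a n * x ^ n :=
        Finset.sum_nonneg fun n _ => hnn n
      have hmono : x * ∑ n ∈ Finset.range (m + 1 + k), a n * x ^ n +
          x * (∑ n ∈ Finset.range (m + 1 + k), a n * x ^ n) ^ 2 ≤ x * v + x * v ^ 2 := by
        gcongr
      rw [← add_assoc]
      linarith
  refine ⟨x, hx4, hx3, v, fun n => le_trans ?_ (hsum n)⟩
  exact Finset.single_le_sum (f := fun n => a n * x ^ n) (fun n _ => hnn n)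
    (Finset.mem_range.2 (by omega))

lemma exists_card_termsAvoiding_mul_pow_le (M : Term) {r : ℝ} (h0 : 0 < r) (h1 : r < 1)
    (hr : (1 - r) ^ 3 = 4 * r ^ 2) :
    ∃ x, r < x ∧ x < 1 ∧
      ∃ C : ℝ, ∀ n, ((termsAvoiding M n).card : ℝ) * x ^ n ≤ C := by
  refine exists_mul_pow_le_of_base_lt (a := fun n => ((termsAvoiding M n).card : ℝ))
    (fun n => Nat.cast_nonneg _) ?_ M.size_pos
    (fun n => by exact_mod_cast card_termsAvoiding_succ_le M n) h0 h1
    (singularity_fixed_point h0 h1 hr)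
    (lt_of_lt_of_le (Finset.sum_lt_sum (fun n _ => ?_) ⟨M.size, by simp, ?_⟩)
      (sum_L_mul_pow_le h0 h1 hr (M.size + 1)))
  · have h := card_termsAvoiding_le M 0
    rw [L_zero] at h
    exact_mod_cast Nat.le_zero.1 h
  · have := card_termsAvoiding_le M n
    gcongr
  · have := card_termsAvoiding_size_lt M
    gcongr
    exact this

lemma tendsto_card_termsAvoiding_div (M : Term) :
    Filter.Tendsto (fun n => ((termsAvoiding M n).card : ℝ) / L n) Filter.atTop (nhds 0) := by
  obtain ⟨r, h0, h1, hr⟩ := exists_singularity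
  obtain ⟨x, hrx, hx1, C, hC⟩ := exists_card_termsAvoiding_mul_pow_le M h0 h1 hr
  obtain ⟨y, hry, hyx⟩ := exists_between hrx
  obtain ⟨c, hc, hL⟩ := exists_le_L_mul_pow h0 hry (hyx.trans hx1) hr
  have hy0 : 0 < y := h0.trans hry
  have hx0 : 0 < x := hy0.trans hyx
  have hlim : Filter.Tendsto (fun n : ℕ => C / c * (y / x) ^ n) Filter.atTop (nhds 0) := by
    simpa using (tendsto_pow_atTop_nhds_zero_of_lt_one (r := y / x) (by positivity)
      ((div_lt_one hx0).2 hyx)).const_mul (C / c)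
  refine squeeze_zero' (Filter.Eventually.of_forall fun n => by positivity) ?_ hlim
  filter_upwards [Filter.eventually_ge_atTop 1] with n hn
  have hLpos : (0 : ℝ) < L n := by exact_mod_cast one_le_L hn
  have hCn : 0 ≤ C := le_trans (by positivity) (hC n)
  calc ((termsAvoiding M n).card : ℝ) / L n
      = ((termsAvoiding M n).card * x ^ n) / (L n * y ^ n) * (y / x) ^ n := by
        rw [div_pow]; field_simp
    _ ≤ C / c * (y / x) ^ n := by
        gcongr
        · exact hC n
        · exact hL n hn

lemma card_subterm_add_card_termsAvoiding (M : Term) (n : ℕ) :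
    Nat.card {T : Term // T.size = n ∧ Subterm M T} + (termsAvoiding M n).card = L n := by
  classical
  have h : Nat.card {T : Term // T.size = n ∧ Subterm M T} =
      ((termsOfSize n).filter fun t => Subterm M t).card := by
    rw [← Nat.card_eq_finsetCard]
    exact Nat.card_congr (Equiv.subtypeEquivRight fun t => by simp [mem_termsOfSize])
  rw [h, L_eq_card, termsAvoiding]
  convert Finset.card_filter_add_card_filter_not (s := termsOfSize n) (fun t => Subterm M t)

theorem subterm_density_one (M : Term) :
    Filter.Tendsto
      (fun n : ℕ =>
        (Nat.card {T : Term // T.size = n ∧ Subterm M T} : ℝ) / (L n : ℝ))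
      Filter.atTop (nhds 1) := by
  have h := (tendsto_card_termsAvoiding_div M).const_sub 1
  rw [sub_zero] at h
  refine h.congr' ?_
  filter_upwards [Filter.eventually_ge_atTop 1] with n hn
  have hLpos : (0 : ℝ) < L n := by exact_mod_cast one_le_L hn
  have hcard : (Nat.card {T : Term // T.size = n ∧ Subterm M T} : ℝ) +
      (termsAvoiding M n).card = L n := by
    exact_mod_cast card_subterm_add_card_termsAvoiding M n
  field_simp
  linarith
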